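/- Let n ≥ 1, p ≥ 0, 0 ≤ m ≤ n be integers and i an integer. Let T_i(n,p,m) be the number of pairs (λ, J) where λ = (λ_0, …, λ_{n−1}) is a tuple of nonnegative integers with λ_0 + ⋯ + λ_{n−1} = p, J is an m-element subset of {0, 1, …, n−1}, and Σ_{j=0}^{n−1} j·λ_j + Σ_{j∈J} j ≡ i (mod n). Then (p+n)·T_i(n,p,m) = (−1)^m · Σ_{d | gcd(n,p,m)} (−1)^{m/d} · c_d(i) · ((n+p)/d)! / ((m/d)!·(p/d)!·((n−m)/d)!), where d runs over the positive common divisors of n, p and m (a divisor of every nonnegative integer counts as dividing 0). -/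

import Mathlib

open Finset

/-- The Ramanujan sum `c_d(i) = Σ_{e | gcd(d,i)} μ(d/e)·e`. -/
def ramanujanSum (d : ℕ) (i : ℤ) : ℤ :=
  ∑ e ∈ (Nat.gcd d i.natAbs).divisors, ArithmeticFunction.moebius (d / e) * (e : ℤ)

open Polynomial in
lemma aux_nthRoots_prod {M : Type*} [CommMonoid M] {d : ℕ} {z : ℂ} (hd : 0 < d)
    (hz : IsPrimitiveRoot z d) (f : ℂ → M) :
    ∏ w ∈ nthRootsFinset d (1 : ℂ), f w = ∏ j ∈ Finset.range d, f (z ^ j) := by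
  symm
  apply Finset.prod_nbij (fun j => z ^ j)
  · intro j _
    rw [mem_nthRootsFinset hd, ← pow_mul, mul_comm, pow_mul, hz.pow_eq_one, one_pow]
  · intro a ha b hb hab
    exact hz.pow_inj (by simpa using ha) (by simpa using hb) hab
  · intro w hw
    have : NeZero d := ⟨hd.ne'⟩
    obtain ⟨j, hj, rfl⟩ := hz.eq_pow_of_pow_eq_one ((mem_nthRootsFinset hd _).1 hw)
    exact ⟨j, by simpa using hj, rfl⟩
  · intros; rfl

open Polynomial in
lemma aux_nthRoots_sum {M : Type*} [AddCommMonoid M] {d : ℕ} {z : ℂ} (hd : 0 < d)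
    (hz : IsPrimitiveRoot z d) (f : ℂ → M) :
    ∑ w ∈ nthRootsFinset d (1 : ℂ), f w = ∑ j ∈ Finset.range d, f (z ^ j) :=
  aux_nthRoots_prod (M := Multiplicative M) hd hz f

lemma aux_prod_range {d : ℕ} {z : ℂ} (hd : 0 < d) (hz : IsPrimitiveRoot z d) :
    ∏ j ∈ Finset.range d, (1 - PowerSeries.C (z ^ j) * PowerSeries.X) =
      (1 - PowerSeries.X ^ d : PowerSeries ℂ) := by
  have h : IsPrimitiveRoot (PowerSeries.C z : PowerSeries ℂ) d :=
    hz.map_of_injective (f := (PowerSeries.C : ℂ →+* PowerSeries ℂ)) PowerSeries.C_injective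
  have := h.pow_sub_pow_eq_prod_sub_mul (1 : PowerSeries ℂ) PowerSeries.X hd
  rw [one_pow] at this
  rw [this]
  apply Finset.prod_nbij (fun j => PowerSeries.C (z ^ j))
  · intro j _
    rw [Polynomial.mem_nthRootsFinset hd, map_pow, ← pow_mul, mul_comm, pow_mul, h.pow_eq_one,
      one_pow]
  · intro a ha b hb hab
    exact hz.pow_inj (by simpa using ha) (by simpa using hb) (PowerSeries.C_injective hab)
  · intro w hw
    have : NeZero d := ⟨hd.ne'⟩
    obtain ⟨j, hj, rfl⟩ := h.eq_pow_of_pow_eq_one ((Polynomial.mem_nthRootsFinset hd _).1 hw)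
    exact ⟨j, by simpa using hj, by simp⟩
  · intros; rfl

lemma aux_prod_mul {d N : ℕ} {z : ℂ} (hd : 0 < d) (hz : IsPrimitiveRoot z d) :
    ∏ j ∈ Finset.range (d * N), (1 - PowerSeries.C (z ^ j) * PowerSeries.X) =
      (1 - PowerSeries.X ^ d : PowerSeries ℂ) ^ N := by
  induction N with
  | zero => simp
  | succ N ih =>
    rw [Nat.mul_succ, Finset.prod_range_add, ih, pow_succ]
    congr 1
    rw [← aux_prod_range hd hz]
    refine Finset.prod_congr rfl fun j _ => ?_
    rw [pow_add, pow_mul, hz.pow_eq_one, one_pow, one_mul]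

lemma aux_prod_fin {d N n : ℕ} {z : ℂ} (hn : n = d * N) (hd : 0 < d) (hz : IsPrimitiveRoot z d) :
    ∏ j : Fin n, (1 - PowerSeries.C (z ^ (j : ℕ)) * PowerSeries.X) =
      (1 - PowerSeries.X ^ d : PowerSeries ℂ) ^ N := by
  rw [Fin.prod_univ_eq_prod_range (fun j => (1 - PowerSeries.C (z ^ j) * PowerSeries.X :
    PowerSeries ℂ)), hn, aux_prod_mul hd hz]

/-- coefficients of `(1 - X)^N`. -/
lemma aux_coeff_one_sub (N M : ℕ) :
    PowerSeries.coeff M ((1 - PowerSeries.X : PowerSeries ℂ) ^ N) = (-1) ^ M * (N.choose M : ℂ) := by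
  have h : (1 - PowerSeries.X : PowerSeries ℂ) ^ N =
      PowerSeries.rescale (-1 : ℂ) (((1 + Polynomial.X : Polynomial ℂ) ^ N : Polynomial ℂ)) := by
    simp [sub_eq_add_neg]
  rw [h, PowerSeries.coeff_rescale, Polynomial.coeff_coe, Polynomial.coeff_one_add_X_pow]

lemma aux_expand (d N : ℕ) (hd : d ≠ 0) : (1 - PowerSeries.X ^ d : PowerSeries ℂ) ^ N =
    PowerSeries.expand d hd ((1 - PowerSeries.X : PowerSeries ℂ) ^ N) := by
  simp

/-- elementary symmetric sums -/
lemma aux_esymm {d N n : ℕ} (m : ℕ) {z : ℂ} (hn : n = d * N) (hd : 0 < d)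
    (hz : IsPrimitiveRoot z d) :
    ∑ J ∈ Finset.powersetCard m (Finset.univ : Finset (Fin n)), z ^ (∑ j ∈ J, (j : ℕ)) =
      if d ∣ m then (-1) ^ m * ((-1) ^ (m / d) * (N.choose (m / d) : ℂ)) else 0 := by
  have h1 : (∏ j : Fin n, (1 + PowerSeries.C (z ^ (j : ℕ)) * PowerSeries.X) : PowerSeries ℂ) =
      PowerSeries.rescale (-1 : ℂ) ((1 - PowerSeries.X ^ d : PowerSeries ℂ) ^ N) := by
    rw [← aux_prod_fin hn hd hz, map_prod]
    refine Finset.prod_congr rfl fun j _ => ?_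
    have hC : PowerSeries.rescale (-1 : ℂ) (PowerSeries.C (z ^ (j : ℕ))) =
        PowerSeries.C (z ^ (j : ℕ)) := by
      ext k
      rw [PowerSeries.coeff_rescale, PowerSeries.coeff_C]
      split_ifs with hk <;> simp [hk]
    rw [map_sub, map_mul, hC]
    simp [-map_pow, sub_eq_add_neg]
  have h2 := congrArg (PowerSeries.coeff m) h1
  rw [PowerSeries.coeff_rescale, aux_expand d N hd.ne', PowerSeries.coeff_expand,
    aux_coeff_one_sub, Finset.prod_one_add, map_sum] at h2
  rw [← mul_ite_zero, ← h2, Finset.powersetCard_eq_filter, Finset.sum_filter]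
  refine Finset.sum_congr rfl fun J _ => ?_
  rw [Finset.prod_mul_distrib, Finset.prod_const, ← map_prod, PowerSeries.coeff_C_mul,
    PowerSeries.coeff_X_pow, Finset.prod_pow_eq_pow_sum]
  by_cases h : J.card = m
  · simp [h]
  · simp [h, Ne.symm h]

lemma aux_hsymm_series {n : ℕ} (z : ℂ) :
    (∏ j : Fin n, PowerSeries.mk (fun k => (z ^ (j : ℕ)) ^ k)) *
     (∏ j : Fin n, (1 - PowerSeries.C (z ^ (j : ℕ)) * PowerSeries.X)) = 1 := by
  rw [← Finset.prod_mul_distrib]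
  refine Finset.prod_eq_one fun j _ => ?_
  have := congrArg (PowerSeries.rescale (z ^ (j : ℕ))) (PowerSeries.mk_one_mul_one_sub_eq_one ℂ)
  rw [map_mul] at this
  rw [map_one] at this
  refine Eq.trans ?_ this
  congr 1
  · ext k; simp [PowerSeries.coeff_rescale]
  · rw [map_sub, map_one, PowerSeries.rescale_X]

lemma aux_hsymm {d N n : ℕ} (p : ℕ) {z : ℂ} (hn : n = d * (N + 1)) (hd : 0 < d)
    (hz : IsPrimitiveRoot z d) :
    ∑ l ∈ Finset.piAntidiag (Finset.univ : Finset (Fin n)) p, z ^ (∑ j : Fin n, (j : ℕ) * l j) =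
      if d ∣ p then ((N + p / d).choose N : ℂ) else 0 := by
  have h1 : (∏ j : Fin n, PowerSeries.mk (fun k => (z ^ (j : ℕ)) ^ k)) =
      PowerSeries.expand d hd.ne' (PowerSeries.mk fun k => ((N + k).choose N : ℂ)) := by
    have h2 := aux_hsymm_series (n := n) z
    have h3 := congrArg (PowerSeries.expand d hd.ne')
      (PowerSeries.mk_add_choose_mul_one_sub_pow_eq_one ℂ N)
    rw [map_mul, ← aux_expand, ← aux_prod_fin hn hd hz, map_one] at h3
    rw [mul_comm] at h3
    exact left_inv_eq_right_inv h2 h3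
  have h2 := congrArg (PowerSeries.coeff p) h1
  rw [PowerSeries.coeff_expand, PowerSeries.coeff_prod] at h2
  simp only [PowerSeries.coeff_mk] at h2
  rw [← h2]
  symm
  apply Finset.sum_nbij (fun l : Fin n →₀ ℕ => (l : Fin n → ℕ))
  · intro l hl; simpa using hl
  · intro a _ b _ h; exact DFunLike.coe_injective h
  · intro l hl
    refine ⟨Finsupp.equivFunOnFinite.symm l, ?_, rfl⟩
    simpa using hl
  · intro l hl
    simp [← pow_mul, Finset.prod_pow_eq_pow_sum]

open Polynomial in
lemma aux_orth {n : ℕ} (hn : 0 < n) (a : ℤ) :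
    ∑ z ∈ nthRootsFinset n (1 : ℂ), z ^ a = if (n : ℤ) ∣ a then (n : ℂ) else 0 := by
  have hz := Complex.isPrimitiveRoot_exp n hn.ne'
  set ζ := Complex.exp (2 * Real.pi * Complex.I / n)
  rw [aux_nthRoots_sum hn hz]
  have h : ∀ j : ℕ, (ζ ^ j) ^ a = (ζ ^ a) ^ j := fun j => by
    rw [← zpow_natCast, ← zpow_natCast, ← zpow_mul, ← zpow_mul, mul_comm]
  simp only [h]
  split_ifs with hd
  · rw [(hz.zpow_eq_one_iff_dvd a).2 hd]; simp
  · have h1 : ζ ^ a ≠ 1 := fun h => hd ((hz.zpow_eq_one_iff_dvd a).1 h)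
    rw [geom_sum_eq h1, ← h, hz.pow_eq_one]; simp

lemma aux_ramanujan {d : ℕ} (hd : 0 < d) (i : ℤ) :
    ∑ z ∈ primitiveRoots d ℂ, z ^ (-i) = (ramanujanSum d i : ℂ) := by
  have key := (ArithmeticFunction.sum_eq_iff_sum_mul_moebius_eq
    (f := fun d => ∑ z ∈ primitiveRoots d ℂ, z ^ (-i))
    (g := fun d => if (d : ℤ) ∣ i then (d : ℂ) else 0)).1 (by
      intro n hn
      rw [← Finset.sum_biUnion, ← IsPrimitiveRoot.nthRoots_one_eq_biUnion_primitiveRoots,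
        aux_orth hn]
      · simp
      · intro a _ b _ hab
        exact IsPrimitiveRoot.disjoint hab) d hd
  rw [← key, ramanujanSum]
  push_cast
  rw [Nat.sum_divisorsAntidiagonal' (fun a b => (ArithmeticFunction.moebius a : ℂ) *
    (if (b : ℤ) ∣ i then (b : ℂ) else 0))]
  symm
  apply Finset.sum_subset_zero_on_sdiff
  · exact Nat.divisors_subset_of_dvd hd.ne' (Nat.gcd_dvd_left _ _)
  · intro x hx
    simp only [Finset.mem_sdiff, Nat.mem_divisors, Nat.dvd_gcd_iff] at hx
    rw [if_neg, mul_zero]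
    rintro h
    exact hx.2 ⟨⟨hx.1.1, by simpa using Int.natAbs_dvd_natAbs.2 h⟩, (Nat.gcd_pos_of_pos_left _ hd).ne'⟩
  · intro x hx
    simp only [Nat.mem_divisors, Nat.dvd_gcd_iff] at hx
    rw [if_pos]
    exact Int.natCast_dvd.2 hx.1.2

lemma aux_fact {N M P : ℕ} (hM : M ≤ N + 1) :
    (N + 1) * ((N + 1 + P).factorial / (M.factorial * (P.factorial * (N + 1 - M).factorial))) =
      (N + 1 + P) * ((N + 1).choose M * (N + P).choose N) := by
  have h1 := Nat.choose_mul_factorial_mul_factorial hM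
  have h2 := Nat.add_choose_mul_factorial_mul_factorial N P
  have h3 : (N + 1) * (N + 1 + P).factorial = (N + 1 + P) * ((N + 1).choose M * (N + P).choose N) *
      (M.factorial * (P.factorial * (N + 1 - M).factorial)) := by
    have : (N + 1 + P).factorial = (N + 1 + P) * (N + P).factorial := by
      rw [show N + 1 + P = (N + P) + 1 by ring, Nat.factorial_succ]
    rw [this, ← h2, ← Nat.choose_symm_add]
    have h4 : (N + 1) * N.factorial = (N + 1).factorial := (Nat.factorial_succ N).symm
    calc _ = (N + 1 + P) * (N + P).choose N * P.factorial * ((N + 1) * N.factorial) := by ring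
      _ = _ := by rw [h4, ← h1]; ring
  have hdvd : (M.factorial * (P.factorial * (N + 1 - M).factorial)) ∣ (N + 1 + P).factorial := by
    have e : N + 1 + P = M + (P + (N + 1 - M)) := by omega
    rw [e]
    exact (mul_dvd_mul_left _ (Nat.factorial_mul_factorial_dvd_factorial_add _ _)).trans
      (Nat.factorial_mul_factorial_dvd_factorial_add _ _)
  rw [← Nat.mul_div_assoc _ hdvd, h3]
  exact Nat.mul_div_cancel _ (by positivity)

lemma aux_term {n p m d : ℕ} (hn : 1 ≤ n) (hm : m ≤ n) (hd : d ∣ n) {z : ℂ}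
    (hz : IsPrimitiveRoot z d) :
    ((p + n : ℕ) : ℂ) *
    ((∑ l ∈ Finset.piAntidiag (Finset.univ : Finset (Fin n)) p, z ^ (∑ j : Fin n, (j : ℕ) * l j)) *
     ∑ J ∈ Finset.powersetCard m (Finset.univ : Finset (Fin n)), z ^ (∑ j ∈ J, (j : ℕ))) =
    n * (if d ∣ p ∧ d ∣ m then (-1) ^ m * ((-1) ^ (m / d) *
      ((Nat.factorial ((n + p) / d) /
            (Nat.factorial (m / d) * (Nat.factorial (p / d) * Nat.factorial ((n - m) / d))) : ℕ) : ℂ))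
      else 0) := by
  have hd0 : 0 < d := Nat.pos_of_dvd_of_pos hd hn
  obtain ⟨K, hK⟩ := hd
  obtain ⟨N, rfl⟩ : ∃ N, K = N + 1 := Nat.exists_eq_succ_of_ne_zero (by rintro rfl; omega)
  rw [aux_hsymm p hK hd0 hz, aux_esymm m hK hd0 hz]
  by_cases h1 : d ∣ p
  swap
  · simp [h1]
  by_cases h2 : d ∣ m
  swap
  · simp [h2]
  rw [if_pos h1, if_pos h2, if_pos ⟨h1, h2⟩]
  obtain ⟨P, rfl⟩ := h1
  obtain ⟨M, rfl⟩ := h2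
  have hM : M ≤ N + 1 := by
    rw [hK] at hm
    exact Nat.le_of_mul_le_mul_left hm hd0
  have e1 : (n + d * P) / d = N + 1 + P := by
    rw [hK, ← Nat.mul_add, Nat.mul_div_cancel_left _ hd0]
  have e2 : (n - d * M) / d = N + 1 - M := by
    rw [hK, ← Nat.mul_sub, Nat.mul_div_cancel_left _ hd0]
  rw [e1, e2, Nat.mul_div_cancel_left _ hd0, Nat.mul_div_cancel_left _ hd0]
  have hf := congrArg (Nat.cast : ℕ → ℂ) (aux_fact (P := P) hM)
  rw [Nat.cast_mul, Nat.cast_mul (N + 1 + P), Nat.cast_mul ((N + 1).choose M)] at hf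
  have hn' : (n : ℂ) = d * ((N + 1 : ℕ) : ℂ) := by rw [hK]; push_cast; ring
  have hpn : ((d * P + n : ℕ) : ℂ) = d * ((N + 1 + P : ℕ) : ℂ) := by rw [hK]; push_cast; ring
  rw [hn', hpn]
  linear_combination (-((d : ℂ) * (-1) ^ (d * M) * (-1) ^ M)) * hf

open Polynomial in
lemma aux_count (n p m : ℕ) (hn : 1 ≤ n) (i : ℤ) :
    (n : ℂ) * (Nat.card {lJ : (Fin n → ℕ) × Finset (Fin n) //
        (∑ j, lJ.1 j) = p ∧ lJ.2.card = m ∧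
        ((∑ j : Fin n, (j : ℤ) * (lJ.1 j : ℤ)) + ∑ j ∈ lJ.2, (j : ℤ)) ≡ i [ZMOD (n : ℤ)]} : ℂ) =
    ∑ z ∈ nthRootsFinset n (1 : ℂ), z ^ (-i) *
    ((∑ l ∈ Finset.piAntidiag (Finset.univ : Finset (Fin n)) p, z ^ (∑ j : Fin n, (j : ℕ) * l j)) *
     ∑ J ∈ Finset.powersetCard m (Finset.univ : Finset (Fin n)), z ^ (∑ j ∈ J, (j : ℕ))) := by
  classical
  set A := Finset.piAntidiag (Finset.univ : Finset (Fin n)) p ×ˢ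
    Finset.powersetCard m (Finset.univ : Finset (Fin n)) with hA
  have hcard : Nat.card {lJ : (Fin n → ℕ) × Finset (Fin n) //
        (∑ j, lJ.1 j) = p ∧ lJ.2.card = m ∧
        ((∑ j : Fin n, (j : ℤ) * (lJ.1 j : ℤ)) + ∑ j ∈ lJ.2, (j : ℤ)) ≡ i [ZMOD (n : ℤ)]} =
      (A.filter (fun lJ : (Fin n → ℕ) × Finset (Fin n) => (n : ℤ) ∣ -i + ((∑ j : Fin n, (j : ℕ) * lJ.1 j : ℕ) +
        (∑ j ∈ lJ.2, (j : ℕ) : ℕ) : ℤ))).card := by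
    apply Nat.subtype_card
    rintro ⟨l, J⟩
    rw [Finset.mem_filter, hA, Finset.mem_product, Finset.mem_piAntidiag, Finset.mem_powersetCard,
      Int.modEq_comm, Int.modEq_iff_dvd]
    push_cast
    rw [neg_add_eq_sub]
    simp [and_assoc]
  rw [hcard, Finset.card_filter]
  push_cast
  rw [Finset.mul_sum]
  have h1 : ∀ z ∈ nthRootsFinset n (1 : ℂ), z ^ (-i) *
    ((∑ l ∈ Finset.piAntidiag (Finset.univ : Finset (Fin n)) p, z ^ (∑ j : Fin n, (j : ℕ) * l j)) *
     ∑ J ∈ Finset.powersetCard m (Finset.univ : Finset (Fin n)), z ^ (∑ j ∈ J, (j : ℕ))) =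
     ∑ lJ ∈ A, z ^ (-i + ((∑ j : Fin n, (j : ℕ) * lJ.1 j : ℕ) +
        (∑ j ∈ lJ.2, (j : ℕ) : ℕ) : ℤ)) := by
    intro z hz
    have hz0 : z ≠ 0 := by
      rintro rfl
      rw [mem_nthRootsFinset hn] at hz
      simp [show n ≠ 0 by omega] at hz
    rw [Finset.sum_mul_sum, ← Finset.sum_product', Finset.mul_sum]
    refine Finset.sum_congr rfl fun x _ => ?_
    rw [zpow_add₀ hz0, zpow_add₀ hz0, zpow_natCast, zpow_natCast]
  rw [Finset.sum_congr rfl h1, Finset.sum_comm]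
  refine Finset.sum_congr rfl fun x _ => ?_
  rw [aux_orth hn]
  push_cast
  split_ifs <;> simp

/-- For `n ≥ 1`, `p ≥ 0`, `0 ≤ m ≤ n` and an integer `i`, let `T_i(n,p,m)` be the number of
pairs `(λ, J)` with `λ : Fin n → ℕ`, `Σ λ_j = p`, `J ⊆ {0,…,n-1}` an `m`-element subset and
`Σ j·λ_j + Σ_{j∈J} j ≡ i (mod n)`.  Then
`(p+n)·T_i(n,p,m) = (−1)^m Σ_{d | gcd(n,p,m)} (−1)^{m/d} c_d(i) ((n+p)/d)!/((m/d)!(p/d)!((n−m)/d)!)`. -/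
theorem dim_isotypic_sym_tensor_ext (n p m : ℕ) (hn : 1 ≤ n) (hm : m ≤ n) (i : ℤ) :
    ((p + n : ℕ) : ℤ) *
      (Nat.card {lJ : (Fin n → ℕ) × Finset (Fin n) //
        (∑ j, lJ.1 j) = p ∧ lJ.2.card = m ∧
        ((∑ j : Fin n, (j : ℤ) * (lJ.1 j : ℤ)) + ∑ j ∈ lJ.2, (j : ℤ)) ≡ i [ZMOD (n : ℤ)]} : ℤ) =
    (-1) ^ m *
      ∑ d ∈ (Nat.gcd n (Nat.gcd p m)).divisors,
        (-1) ^ (m / d) * ramanujanSum d i *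
          ((Nat.factorial ((n + p) / d) /
            (Nat.factorial (m / d) * (Nat.factorial (p / d) * Nat.factorial ((n - m) / d))) : ℕ) : ℤ) := by
  have hn0 : (n : ℂ) ≠ 0 := by exact_mod_cast (show n ≠ 0 by omega)
  apply Int.cast_injective (α := ℂ)
  apply mul_left_cancel₀ hn0
  rw [Int.cast_mul, Int.cast_natCast, Int.cast_natCast, mul_left_comm, aux_count n p m hn i,
    IsPrimitiveRoot.nthRoots_one_eq_biUnion_primitiveRoots, Finset.sum_biUnion, Finset.mul_sum]
  swap
  · intro a _ b _ hab
    exact IsPrimitiveRoot.disjoint hab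
  have hterm : ∀ d ∈ n.divisors, ((p + n : ℕ) : ℂ) * ∑ z ∈ primitiveRoots d ℂ, z ^ (-i) *
      ((∑ l ∈ Finset.piAntidiag (Finset.univ : Finset (Fin n)) p,
        z ^ (∑ j : Fin n, (j : ℕ) * l j)) *
      ∑ J ∈ Finset.powersetCard m (Finset.univ : Finset (Fin n)), z ^ (∑ j ∈ J, (j : ℕ))) =
      n * (if d ∣ p ∧ d ∣ m then (-1) ^ m * ((-1) ^ (m / d) * (ramanujanSum d i : ℂ) *
      ((Nat.factorial ((n + p) / d) /
            (Nat.factorial (m / d) * (Nat.factorial (p / d) * Nat.factorial ((n - m) / d))) : ℕ) : ℂ))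
      else 0) := by
    intro d hd
    have hdn := Nat.dvd_of_mem_divisors hd
    have hd0 : 0 < d := Nat.pos_of_mem_divisors hd
    rw [← aux_ramanujan hd0, Finset.mul_sum]
    have hz : ∀ z ∈ primitiveRoots d ℂ, _ := fun z hz =>
      aux_term (p := p) hn hm hdn ((mem_primitiveRoots hd0).1 hz)
    rw [Finset.sum_congr rfl fun z h => by rw [mul_left_comm, hz z h]]
    rw [← Finset.sum_mul]
    split_ifs
    · ring
    · simp
  rw [Finset.sum_congr rfl hterm, ← Finset.mul_sum, ← Finset.sum_filter, ← Finset.mul_sum]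
  have hset : n.divisors.filter (fun d => d ∣ p ∧ d ∣ m) = (Nat.gcd n (Nat.gcd p m)).divisors := by
    ext d
    simp only [Finset.mem_filter, Nat.mem_divisors, Nat.dvd_gcd_iff]
    have : Nat.gcd n (Nat.gcd p m) ≠ 0 := (Nat.gcd_pos_of_pos_left _ hn).ne'
    have : n ≠ 0 := by omega
    tauto
  rw [hset]
  push_cast
  rfl
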